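/- Let E be an elliptic curve over a finite field F_q and a = q + 1 - #E(F_q). Then every complex zero s of the function L_E(s) = 1 - a·q^{-s} + q^{1-2s} satisfies Re(s) = 1/2. -/

import Mathlib

namespace WeierstrassCurve.Affine.Point

open MvPolynomial

variable {K : Type*} [Field K] [DecidableEq K] (W : WeierstrassCurve K)

lemma eval_addSubMap {R : Type*} [CommRing R] (W : WeierstrassCurve R) (x : Fin 3 → R) :
    (fun i ↦ (addSubMap W i).eval x) =
      ![x 0 ^ 2 - W.b₄ * x 0 * x 2 - W.b₆ * x 1 * x 2 - W.b₈ * x 2 ^ 2,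
        2 * x 1 * x 0 + W.b₂ * x 0 * x 2 + W.b₄ * x 1 * x 2 + W.b₆ * x 2 ^ 2,
        x 1 ^ 2 - 4 * x 0 * x 2] := by
  ext i
  fin_cases i <;> simp [addSubMap]

lemma addX_slope_mul_addX_slope_negY {x₁ x₂ y₁ y₂ : K} (h₁ : W.toAffine.Equation x₁ y₁)
    (h₂ : W.toAffine.Equation x₂ y₂) (hx : x₁ ≠ x₂) :
    (x₁ * x₂) ^ 2 - W.b₄ * (x₁ * x₂) - W.b₆ * (x₁ + x₂) - W.b₈ = (x₁ - x₂) ^ 2 *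
      (W.toAffine.addX x₁ x₂ (W.toAffine.slope x₁ x₂ y₁ y₂) *
        W.toAffine.addX x₁ x₂ (W.toAffine.slope x₁ x₂ y₁ (W.toAffine.negY x₂ y₂))) := by
  have hd : x₁ - x₂ ≠ 0 := sub_ne_zero.2 hx
  rw [equation_iff] at h₁ h₂
  rw [slope_of_X_ne hx, slope_of_X_ne hx, addX, addX, negY, b₄, b₆, b₈]
  field_simp
  grind

lemma addX_slope_add_addX_slope_negY {x₁ x₂ y₁ y₂ : K} (h₁ : W.toAffine.Equation x₁ y₁)
    (h₂ : W.toAffine.Equation x₂ y₂) (hx : x₁ ≠ x₂) :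
    2 * (x₁ + x₂) * (x₁ * x₂) + W.b₂ * (x₁ * x₂) + W.b₄ * (x₁ + x₂) + W.b₆ = (x₁ - x₂) ^ 2 *
      (W.toAffine.addX x₁ x₂ (W.toAffine.slope x₁ x₂ y₁ y₂) +
        W.toAffine.addX x₁ x₂ (W.toAffine.slope x₁ x₂ y₁ (W.toAffine.negY x₂ y₂))) := by
  have hd : x₁ - x₂ ≠ 0 := sub_ne_zero.2 hx
  rw [equation_iff] at h₁ h₂
  rw [slope_of_X_ne hx, slope_of_X_ne hx, addX, addX, negY, b₄, b₆, b₂]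
  field_simp
  grind

variable {W} in
omit [DecidableEq K] in
lemma sub_negY_sq {x y : K} (h : W.toAffine.Equation x y) :
    4 * x ^ 3 + W.b₂ * x ^ 2 + 2 * W.b₄ * x + W.b₆ = (y - W.toAffine.negY x y) ^ 2 := by
  rw [equation_iff] at h
  rw [negY, b₂, b₄, b₆]
  linear_combination -4 * h

lemma addX_slope_self {x y : K} (h : W.toAffine.Equation x y) (hy : y ≠ W.toAffine.negY x y) :
    x ^ 4 - W.b₄ * x ^ 2 - 2 * W.b₆ * x - W.b₈ = (4 * x ^ 3 + W.b₂ * x ^ 2 + 2 * W.b₄ * x + W.b₆) *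
      W.toAffine.addX x x (W.toAffine.slope x x y y) := by
  have hd : y - W.toAffine.negY x y ≠ 0 := sub_ne_zero.2 hy
  rw [sub_negY_sq h, slope_of_Y_ne rfl hy, addX]
  rw [equation_iff] at h
  field_simp
  rw [negY, b₄, b₆, b₈]
  grind

/-- The map `addSubMap` sends the symmetric product of the `x`-coordinates of `P` and `Q` to that
of `P + Q` and `P - Q`. -/
lemma addSubMap_sym2x (P Q : W.toAffine.Point) : ∃ c : K,
    (fun i ↦ (addSubMap W i).eval (P.sym2x Q)) = c • (P + Q).sym2x (P - Q) := by
  simp only [eval_addSubMap]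
  have key : ∀ (x y : K) (h : W.toAffine.Nonsingular x y), ∃ c : K,
      ![(x * x) ^ 2 - W.b₄ * (x * x) * 1 - W.b₆ * (x + x) * 1 - W.b₈ * 1 ^ 2,
        2 * (x + x) * (x * x) + W.b₂ * (x * x) * 1 + W.b₄ * (x + x) * 1 + W.b₆ * 1 ^ 2,
        (x + x) ^ 2 - 4 * (x * x) * 1] = c • (some x y h + some x y h).sym2x 0 := by
    intro x y h
    by_cases hy : y = W.toAffine.negY x y
    · refine ⟨x ^ 4 - W.b₄ * x ^ 2 - 2 * W.b₆ * x - W.b₈, ?_⟩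
      rw [add_self_of_Y_eq hy, sym2x_zero_zero]
      have := sub_negY_sq h.left
      rw [← hy, sub_self] at this
      ext i
      fin_cases i <;> simp
      · ring
      · linear_combination this
      · ring
    · refine ⟨4 * x ^ 3 + W.b₂ * x ^ 2 + 2 * W.b₄ * x + W.b₆, ?_⟩
      rw [add_self_of_Y_ne hy, sym2x_some_zero]
      ext i
      fin_cases i <;> simp
      · have := addX_slope_self W h.left hy
        rw [addX] at this
        rw [← this]
        ring
      · ring
      · ring
  rcases P with _ | ⟨x₁, y₁, h₁⟩ <;> rcases Q with _ | ⟨x₂, y₂, h₂⟩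
  · refine ⟨1, ?_⟩
    rw [← zero_def]
    ext i
    fin_cases i <;> simp
  · refine ⟨1, ?_⟩
    rw [← zero_def, zero_add, zero_sub, sym2x_neg_right, sym2x_some_some, sym2x_zero_some]
    ext i
    fin_cases i <;> simp <;> ring
  · refine ⟨1, ?_⟩
    rw [← zero_def, add_zero, sub_zero, sym2x_some_some, sym2x_some_zero]
    ext i
    fin_cases i <;> simp <;> ring
  · rw [sym2x_some_some]
    simp only [Matrix.cons_val_zero, Matrix.cons_val_one, Matrix.cons_val]
    by_cases hx : x₁ = x₂
    · subst hx
      rcases Y_eq_of_X_eq h₁.left h₂.left rfl with hy | hy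
      · subst hy
        rw [sub_self]
        exact key x₁ y₁ h₁
      · have hPQ : some x₁ y₁ h₁ = -some x₁ y₂ h₂ := by
          rw [neg_some, some.injEq]
          exact ⟨rfl, hy⟩
        rw [hPQ, neg_add_cancel, ← neg_add', sym2x_neg_right, sym2x_comm]
        exact key x₁ y₂ h₂
    · refine ⟨(x₁ - x₂) ^ 2, ?_⟩
      rw [sub_eq_add_neg (some x₁ y₁ h₁), neg_some, add_of_X_ne hx, add_of_X_ne hx, sym2x_some_some]
      ext i
      fin_cases i
      · simpa using addX_slope_mul_addX_slope_negY W h₁.left h₂.left hx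
      · simpa using addX_slope_add_addX_slope_negY W h₁.left h₂.left hx
      · simp
        ring

end WeierstrassCurve.Affine.Point

open Polynomial

section Heights

variable {F : Type*} [Field F] {ι : Type*}

/-- The polynomial vector `t` has maximal degree exactly `n`. -/
def HasMaxDegree (t : ι → F[X]) (n : ℕ) : Prop :=
  (∀ i, (t i).natDegree ≤ n) ∧ ∃ i, (t i).coeff n ≠ 0

/-- The entries of the polynomial vector `t` generate the unit ideal. -/
def IsUnimodular (t : ι → F[X]) : Prop :=
  Ideal.span (Set.range t) = ⊤

lemma HasMaxDegree.unique {t : ι → F[X]} {m n : ℕ} (hm : HasMaxDegree t m)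
    (hn : HasMaxDegree t n) : m = n := by
  obtain ⟨i, hi⟩ := hm.2
  obtain ⟨j, hj⟩ := hn.2
  exact le_antisymm ((le_natDegree_of_ne_zero hi).trans (hn.1 i))
    ((le_natDegree_of_ne_zero hj).trans (hm.1 j))

lemma HasMaxDegree.smul {t : ι → F[X]} {n : ℕ} (h : HasMaxDegree t n) {e : F[X]} (he : e ≠ 0) :
    HasMaxDegree (e • t) (e.natDegree + n) := by
  obtain ⟨h, i, hi⟩ := h
  refine ⟨fun j ↦ natDegree_mul_le.trans (Nat.add_le_add_left (h j) _), i, ?_⟩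
  rw [Pi.smul_apply, smul_eq_mul, coeff_mul_add_eq_of_natDegree_le le_rfl (h i)]
  exact mul_ne_zero (leadingCoeff_ne_zero.2 he) hi

lemma exists_hasMaxDegree [Fintype ι] {t : ι → F[X]} (ht : t ≠ 0) : ∃ n, HasMaxDegree t n := by
  classical
  obtain ⟨i, hi⟩ := Function.ne_iff.1 ht
  obtain ⟨j, hj, hmax⟩ := Finset.exists_max_image (Finset.univ.filter fun i ↦ t i ≠ 0)
    (fun i ↦ (t i).natDegree) ⟨i, by simpa using hi⟩
  refine ⟨(t j).natDegree, fun k ↦ ?_, j, ?_⟩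
  · by_cases hk : t k = 0
    · simp [hk]
    · exact hmax k (by simpa using hk)
  · simpa using hj

lemma IsUnimodular.ne_zero {t : ι → F[X]} (ht : IsUnimodular t) : t ≠ 0 := by
  rintro rfl
  refine top_ne_bot (α := Ideal F[X]) (ht.symm.trans ?_)
  rw [Ideal.span_eq_bot]
  rintro _ ⟨i, rfl⟩
  rfl

lemma isUnimodular_of_forall_prime {t : ι → F[X]}
    (h : ∀ I : Ideal F[X], I.IsPrime → ¬ ∀ i, t i ∈ I) : IsUnimodular t := by
  by_contra ht
  obtain ⟨M, hM, hle⟩ := Ideal.exists_le_maximal _ ht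
  exact h M hM.isPrime fun i ↦ hle (Ideal.subset_span ⟨i, rfl⟩)

lemma IsUnimodular.not_forall_mem {t : ι → F[X]} (ht : IsUnimodular t) (I : Ideal F[X])
    (hI : I.IsPrime) : ¬ ∀ i, t i ∈ I := fun h ↦
  hI.ne_top (top_le_iff.1 (ht.symm.le.trans (Ideal.span_le.2 (by rintro _ ⟨i, rfl⟩; exact h i))))

variable {K : Type*} [Field K] [Algebra F[X] K] [FaithfulSMul F[X] K]

lemma IsUnimodular.exists_eq_smul [Fintype ι] {t g : ι → F[X]} (ht : IsUnimodular t) {c : K}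
    (h : ∀ i, algebraMap F[X] K (g i) = c * algebraMap F[X] K (t i)) :
    ∃ e, algebraMap F[X] K e = c ∧ g = e • t := by
  obtain ⟨a, ha⟩ := Ideal.mem_span_range_iff_exists_fun.1 ((Ideal.eq_top_iff_one _).1 ht)
  have he : algebraMap F[X] K (∑ i, a i * g i) = c := by
    simp_rw [map_sum, map_mul, h, mul_left_comm _ c, ← map_mul, ← Finset.mul_sum, ← map_sum, ha,
      map_one, mul_one]
  refine ⟨_, he, funext fun i ↦ FaithfulSMul.algebraMap_injective F[X] K ?_⟩
  rw [h, Pi.smul_apply, smul_eq_mul, map_mul, he]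

lemma HasMaxDegree.eq_of_proportional [Fintype ι] {t g : ι → F[X]} {m n : ℕ}
    (ht : IsUnimodular t) (hg : IsUnimodular g) (hm : HasMaxDegree t m) (hn : HasMaxDegree g n)
    {c : K} (h : ∀ i, algebraMap F[X] K (g i) = c * algebraMap F[X] K (t i)) : m = n := by
  obtain ⟨e, he, rfl⟩ := ht.exists_eq_smul h
  have he0 : e ≠ 0 := by
    rintro rfl
    exact hg.ne_zero (zero_smul _ _)
  have hc : c ≠ 0 := by
    rw [← he]
    simpa using he0
  obtain ⟨e', he', -⟩ := hg.exists_eq_smul (c := c⁻¹) (g := t) fun i ↦ by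
    rw [h, inv_mul_cancel_left₀ hc]
  have hu : e * e' = 1 := FaithfulSMul.algebraMap_injective F[X] K <| by
    rw [map_mul, he, he', mul_inv_cancel₀ hc, map_one]
  have := (hm.smul he0).unique hn
  rwa [natDegree_eq_zero_of_isUnit (IsUnit.of_mul_eq_one _ hu), zero_add] at this

/-- The symmetric product of two vectors of length two. -/
def symMul {R : Type*} [CommRing R] (r r' : Fin 2 → R) : Fin 3 → R :=
  ![r 0 * r' 0, r 0 * r' 1 + r 1 * r' 0, r 1 * r' 1]

lemma symMul_mem {R : Type*} [CommRing R] {r r' : Fin 2 → R} {I : Ideal R} (hI : I.IsPrime)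
    (h : ∀ i, symMul r r' i ∈ I) : (∀ i, r i ∈ I) ∨ ∀ i, r' i ∈ I := by
  have h0 : r 0 * r' 0 ∈ I := h 0
  have h1 : r 0 * r' 1 + r 1 * r' 0 ∈ I := h 1
  have h2 : r 1 * r' 1 ∈ I := h 2
  simp only [Fin.forall_fin_two]
  rcases hI.mem_or_mem h0 with h | h <;> rcases hI.mem_or_mem h2 with h' | h'
  · exact .inl ⟨h, h'⟩
  · rcases hI.mem_or_mem ((I.add_mem_iff_right (I.mul_mem_right _ h)).1 h1) with h | h <;> tauto
  · rcases hI.mem_or_mem ((I.add_mem_iff_left (I.mul_mem_right _ h')).1 h1) with h | h <;> tauto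
  · exact .inr ⟨h, h'⟩

lemma IsUnimodular.symMul {r r' : Fin 2 → F[X]} (hr : IsUnimodular r) (hr' : IsUnimodular r') :
    IsUnimodular (symMul r r') :=
  isUnimodular_of_forall_prime fun I hI h ↦
    (symMul_mem hI h).elim (hr.not_forall_mem I hI) (hr'.not_forall_mem I hI)

lemma HasMaxDegree.symMul {r r' : Fin 2 → F[X]} {m n : ℕ} (hr : HasMaxDegree r m)
    (hr' : HasMaxDegree r' n) : HasMaxDegree (symMul r r') (m + n) := by
  obtain ⟨hr, i, hi⟩ := hr
  obtain ⟨hr', j, hj⟩ := hr'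
  have hd (i j) : (r i * r' j).natDegree ≤ m + n :=
    natDegree_mul_le.trans (add_le_add (hr i) (hr' j))
  refine ⟨fun k ↦ ?_, ?_⟩
  · fin_cases k
    exacts [hd 0 0, natDegree_add_le_of_degree_le (hd 0 1) (hd 1 0), hd 1 1]
  · by_contra! h
    have hs (k) :
        _root_.symMul (fun i ↦ (r i).coeff m) (fun i ↦ (r' i).coeff n) k ∈ (⊥ : Ideal F) := by
      rw [Ideal.mem_bot, ← h k]
      fin_cases k <;>
        simp [_root_.symMul, coeff_mul_add_eq_of_natDegree_le (hr _) (hr' _)]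
    rcases symMul_mem Ideal.isPrime_bot hs with h | h
    exacts [hi (h i), hj (h j)]

variable (E : WeierstrassCurve F)

/-- The addition-and-subtraction map on vectors of polynomials. -/
noncomputable def addSubPoly (s : Fin 3 → F[X]) : Fin 3 → F[X] :=
  fun i ↦ ((E.map C).addSubMap i).eval s

lemma IsUnimodular.addSubPoly [E.IsElliptic] {s : Fin 3 → F[X]} (hs : IsUnimodular s) :
    IsUnimodular (addSubPoly E s) :=
  isUnimodular_of_forall_prime fun I hI h ↦ hs.not_forall_mem I hI fun i ↦
    hI.mem_of_pow_mem 4 <| by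
      rw [← (E.map C).addSubMapCoeff_condition s i]
      exact I.sum_mem fun j _ ↦ I.mul_mem_left _ (h j)

lemma HasMaxDegree.addSubPoly [E.IsElliptic] {s : Fin 3 → F[X]} {n : ℕ} (hs : HasMaxDegree s n) :
    HasMaxDegree (addSubPoly E s) (n + n) := by
  obtain ⟨h, i, hi⟩ := hs
  have hd (a : F) (i j) : (C a * s i * s j).natDegree ≤ n + n :=
    natDegree_mul_le.trans (add_le_add ((natDegree_C_mul_le _ _).trans (h i)) (h j))
  have hc (a : F) (i j) : (C a * s i * s j).coeff (n + n) = a * (s i).coeff n * (s j).coeff n := by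
    rw [coeff_mul_add_eq_of_natDegree_le ((natDegree_C_mul_le _ _).trans (h i)) (h j), coeff_C_mul]
  have hE : _root_.addSubPoly E s =
      ![C 1 * s 0 * s 0 - C E.b₄ * s 0 * s 2 - C E.b₆ * s 1 * s 2 - C E.b₈ * s 2 * s 2,
        C 2 * s 1 * s 0 + C E.b₂ * s 0 * s 2 + C E.b₄ * s 1 * s 2 + C E.b₆ * s 2 * s 2,
        C 1 * s 1 * s 1 - C 4 * s 0 * s 2] := by
    refine (WeierstrassCurve.Affine.Point.eval_addSubMap _ _).trans ?_
    have h2 : (C 2 : F[X]) = 2 := map_ofNat C 2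
    have h4 : (C 4 : F[X]) = 4 := map_ofNat C 4
    ext1 i
    fin_cases i <;> simp [h2, h4] <;> ring
  refine ⟨fun k ↦ ?_, ?_⟩
  · have hs {p r : F[X]} (hp : p.natDegree ≤ n + n) (hr : r.natDegree ≤ n + n) :
        (p - r).natDegree ≤ n + n := (natDegree_sub_le_of_le hp hr).trans (max_self _).le
    rw [hE]
    fin_cases k
    · exact hs (hs (hs (hd ..) (hd ..)) (hd ..)) (hd ..)
    · exact natDegree_add_le_of_degree_le (natDegree_add_le_of_degree_le
        (natDegree_add_le_of_degree_le (hd ..) (hd ..)) (hd ..)) (hd ..)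
    · exact hs (hd ..) (hd ..)
  · have := E.addSubMap_ne_zero (x := fun i ↦ (s i).coeff n) fun h ↦ hi (congrFun h i)
    contrapose! this
    ext k
    rw [Pi.zero_apply, ← this k, hE, congrFun (WeierstrassCurve.Affine.Point.eval_addSubMap E _) k]
    fin_cases k <;> simp only [Fin.zero_eta, Fin.mk_one, Fin.reduceFinMk, Matrix.cons_val_zero,
      Matrix.cons_val_one, Matrix.cons_val, coeff_sub, coeff_add, hc] <;> ring

end Heights

section PointHeights

open WeierstrassCurve.Affine

variable {F : Type*} [Field F] {K : Type*} [Field K] [Algebra F K] [Algebra F[X] K]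
  {E : WeierstrassCurve F}

/-- The `x`-coordinate of `P` is represented by a unimodular vector of polynomials of maximal
degree `n`. -/
def HasHeight (P : (E⁄K).Point) (n : ℕ) : Prop :=
  ∃ r : Fin 2 → F[X], IsUnimodular r ∧ HasMaxDegree r n ∧
    ∃ c : K, ∀ i, algebraMap F[X] K (r i) = c * P.xRep i

lemma HasHeight.of_xRep_eq {P Q : (E⁄K).Point} {n : ℕ} (h : HasHeight P n)
    (hPQ : P.xRep = Q.xRep) : HasHeight Q n := by
  rwa [HasHeight, ← hPQ]

lemma HasHeight.unique [FaithfulSMul F[X] K] {P : (E⁄K).Point} {m n : ℕ} (hm : HasHeight P m)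
    (hn : HasHeight P n) : m = n := by
  obtain ⟨r, hu, hd, c, h⟩ := hm
  obtain ⟨r', hu', hd', c', h'⟩ := hn
  have hc : c ≠ 0 := by
    rintro rfl
    refine hu.ne_zero (funext fun i ↦ FaithfulSMul.algebraMap_injective F[X] K ?_)
    rw [h, zero_mul, Pi.zero_apply, map_zero]
  refine hd.eq_of_proportional (K := K) hu hu' hd' (c := c' / c) fun i ↦ ?_
  rw [h, h', ← mul_assoc, div_mul_cancel₀ _ hc]

lemma map_symMul {R S : Type*} [CommRing R] [CommRing S] (f : R →+* S) (r r' : Fin 2 → R)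
    (i : Fin 3) : f (symMul r r' i) = symMul (f ∘ r) (f ∘ r') i := by
  fin_cases i <;> simp [symMul]

lemma symMul_smul_smul {R : Type*} [CommRing R] (r r' : Fin 2 → R) (c c' : R) :
    symMul (c • r) (c' • r') = (c * c') • symMul r r' := by
  ext i
  fin_cases i <;> simp [symMul] <;> ring

lemma map_addSubPoly [IsScalarTower F F[X] K] (s : Fin 3 → F[X]) (i : Fin 3) :
    algebraMap F[X] K (addSubPoly E s i) =
      ((E⁄K).addSubMap i).eval fun j ↦ algebraMap F[X] K (s j) := by
  have hC (a : F) : algebraMap F[X] K (C a) = algebraMap F K a :=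
    (IsScalarTower.algebraMap_apply F F[X] K a).symm
  have h1 := congrFun (Point.eval_addSubMap (E.map C) s) i
  have h2 := congrFun (Point.eval_addSubMap (E⁄K) fun j ↦ algebraMap F[X] K (s j)) i
  rw [h2, addSubPoly, h1]
  have ht : algebraMap F[X] K 2 = 2 := map_ofNat _ 2
  have hf : algebraMap F[X] K 4 = 4 := map_ofNat _ 4
  fin_cases i <;> simp [hC, ht, hf, WeierstrassCurve.baseChange]

lemma eval_smul_addSubMap {R : Type*} [CommRing R] (W : WeierstrassCurve R) (c : R)
    (s : Fin 3 → R) (i : Fin 3) :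
    (W.addSubMap i).eval (c • s) = c ^ 2 * (W.addSubMap i).eval s := by
  have h1 := congrFun (Point.eval_addSubMap W (c • s)) i
  have h2 := congrFun (Point.eval_addSubMap W s) i
  rw [h1, h2]
  fin_cases i <;> simp <;> ring

/-- The parallelogram law for the height on points over the function field. -/
lemma HasHeight.parallelogram [FaithfulSMul F[X] K] [IsScalarTower F F[X] K] [DecidableEq K]
    [E.IsElliptic] {P Q : (E⁄K).Point} {a b c d : ℕ}
    (hP : HasHeight P a) (hQ : HasHeight Q b) (hadd : HasHeight (P + Q) c)
    (hsub : HasHeight (P - Q) d) : c + d = 2 * a + 2 * b := by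
  obtain ⟨r₁, hu₁, hd₁, c₁, h₁⟩ := hP
  obtain ⟨r₂, hu₂, hd₂, c₂, h₂⟩ := hQ
  obtain ⟨r₃, hu₃, hd₃, c₃, h₃⟩ := hadd
  obtain ⟨r₄, hu₄, hd₄, c₄, h₄⟩ := hsub
  have hmap {P Q : (E⁄K).Point} {r r' : Fin 2 → F[X]} {c c' : K}
      (h : ∀ i, algebraMap F[X] K (r i) = c * P.xRep i)
      (h' : ∀ i, algebraMap F[X] K (r' i) = c' * Q.xRep i) (i : Fin 3) :
      algebraMap F[X] K (symMul r r' i) = ((c * c') • P.sym2x Q) i := by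
    have e : algebraMap F[X] K ∘ r = c • P.xRep := funext h
    have e' : algebraMap F[X] K ∘ r' = c' • Q.xRep := funext h'
    rw [map_symMul, e, e', symMul_smul_smul]
    rfl
  obtain ⟨k, hk⟩ := Point.addSubMap_sym2x (E⁄K) P Q
  have hg (i : Fin 3) : algebraMap F[X] K (addSubPoly E (symMul r₁ r₂) i) =
      ((c₁ * c₂) ^ 2 * k) * (P + Q).sym2x (P - Q) i := by
    rw [map_addSubPoly, funext (hmap h₁ h₂), eval_smul_addSubMap, mul_assoc]
    congr 1
    exact congrFun hk i
  have ht := hmap h₃ h₄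
  have hut := hu₃.symMul hu₄
  have hc : c₃ * c₄ ≠ 0 := by
    intro h
    refine hut.ne_zero (funext fun i ↦ FaithfulSMul.algebraMap_injective F[X] K ?_)
    rw [ht, h, zero_smul, Pi.zero_apply, Pi.zero_apply, map_zero]
  have := (hd₃.symMul hd₄).eq_of_proportional (K := K) hut ((hu₁.symMul hu₂).addSubPoly E)
    ((hd₁.symMul hd₂).addSubPoly E) (c := (c₁ * c₂) ^ 2 * k / (c₃ * c₄)) fun i ↦ by
      rw [hg, ht, Pi.smul_apply, smul_eq_mul, ← mul_assoc, div_mul_cancel₀ _ hc]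
  omega

lemma exists_hasHeight [FaithfulSMul F[X] K] {P : (E⁄K).Point} {u : Fin 2 → F[X]} (hu : u ≠ 0)
    {c : K} (h : ∀ i, algebraMap F[X] K (u i) = c * P.xRep i) : ∃ n, HasHeight P n := by
  obtain ⟨r, hr⟩ : ∃ r, IsUnimodular r ∧ ∃ g, u = g • r := by
    obtain ⟨g, hg⟩ := (IsPrincipalIdealRing.principal (Ideal.span (Set.range u)))
    have hg0 : g ≠ 0 := by
      rintro rfl
      rw [Submodule.span_zero_singleton, Ideal.span_eq_bot] at hg
      exact hu (funext fun i ↦ hg _ ⟨i, rfl⟩)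
    have hdvd (i) : g ∣ u i := by
      rw [← Ideal.mem_span_singleton]
      exact hg.le (Ideal.subset_span ⟨i, rfl⟩)
    choose r hr using hdvd
    obtain ⟨a, ha⟩ := Ideal.mem_span_range_iff_exists_fun.1
      (hg.ge (Ideal.mem_span_singleton_self g))
    refine ⟨r, ?_, g, funext hr⟩
    rw [IsUnimodular, Ideal.eq_top_iff_one, Ideal.mem_span_range_iff_exists_fun]
    refine ⟨a, mul_left_cancel₀ hg0 ?_⟩
    simp_rw [hr] at ha
    rw [mul_one, Finset.mul_sum]
    simpa only [mul_left_comm] using ha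
  obtain ⟨hr, g, rfl⟩ := hr
  have hg0 : algebraMap F[X] K g ≠ 0 := by
    intro h
    rw [map_eq_zero_iff _ (FaithfulSMul.algebraMap_injective F[X] K)] at h
    exact hu (by rw [h, zero_smul])
  obtain ⟨n, hn⟩ := exists_hasMaxDegree hr.ne_zero
  refine ⟨n, r, hr, hn, (algebraMap F[X] K g)⁻¹ * c, fun i ↦ ?_⟩
  rw [mul_assoc, ← h, Pi.smul_apply, smul_eq_mul, map_mul, inv_mul_cancel_left₀ hg0]

lemma HasHeight.add_natDegree_le [FaithfulSMul F[X] K] {P : (E⁄K).Point} {n m : ℕ}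
    (hP : HasHeight P n) {u : Fin 2 → F[X]} (hu : u ≠ 0) {c : K}
    (h : ∀ i, algebraMap F[X] K (u i) = c * P.xRep i) {g : F[X]} (hg : ∀ i, g ∣ u i)
    (hm : ∀ i, (u i).natDegree ≤ m) : n + g.natDegree ≤ m := by
  obtain ⟨r, hur, hdr, k, hk⟩ := hP
  have hk0 : k ≠ 0 := by
    rintro rfl
    refine hur.ne_zero (funext fun i ↦ FaithfulSMul.algebraMap_injective F[X] K ?_)
    rw [hk, zero_mul, Pi.zero_apply, map_zero]
  obtain ⟨e, -, rfl⟩ := hur.exists_eq_smul (K := K) (c := c / k) (g := u) fun i ↦ by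
    rw [h, hk, ← mul_assoc, div_mul_cancel₀ _ hk0]
  have hge : g ∣ e := by
    obtain ⟨a, ha⟩ := Ideal.mem_span_range_iff_exists_fun.1 ((Ideal.eq_top_iff_one _).1 hur)
    rw [← mul_one e, ← ha, Finset.mul_sum]
    refine Finset.dvd_sum fun i _ ↦ ?_
    rw [mul_left_comm]
    exact (hg i).mul_left _
  have he : e ≠ 0 := by
    rintro rfl
    exact hu (zero_smul _ _)
  obtain ⟨h1, i, hi⟩ := hdr.smul he
  have := (le_natDegree_of_ne_zero hi).trans (hm i)
  have := natDegree_le_of_dvd hge he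
  omega

end PointHeights

namespace WeierstrassCurve.Affine

variable {F : Type*} [Field F] (E : WeierstrassCurve F)

/-- The class of `Y` in the coordinate ring. -/
noncomputable def coordY : E.toAffine.CoordinateRing :=
  CoordinateRing.mk E.toAffine Polynomial.X

/-- The cubic in the Weierstrass equation `Y ^ 2 + linearPart * Y = cubicPart`. -/
noncomputable def cubicPart : F[X] := X ^ 3 + C E.a₂ * X ^ 2 + C E.a₄ * X + C E.a₆

/-- The coefficient of `Y` in the Weierstrass equation `Y ^ 2 + linearPart * Y = cubicPart`. -/
noncomputable def linearPart : F[X] := C E.a₁ * X + C E.a₃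

lemma coordY_sq :
    coordY E ^ 2 + algebraMap F[X] _ (linearPart E) * coordY E =
      algebraMap F[X] _ (cubicPart E) := by
  have : CoordinateRing.mk E.toAffine (Polynomial.X ^ 2 + C (linearPart E) * Polynomial.X) =
      CoordinateRing.mk E.toAffine (C (cubicPart E)) :=
    AdjoinRoot.mk_eq_mk.mpr ⟨1, by rw [polynomial, linearPart, cubicPart]; ring1⟩
  rwa [map_add, map_mul, map_pow] at this

/-- The involution of the coordinate ring induced by negation on the curve. -/
noncomputable def negHom : E.toAffine.CoordinateRing →ₐ[F[X]] E.toAffine.CoordinateRing :=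
  AdjoinRoot.liftAlgHom _ (Algebra.ofId _ _) (-coordY E - algebraMap F[X] _ (linearPart E)) <| by
    have hp : E.toAffine.polynomial =
        Polynomial.X ^ 2 + C (linearPart E) * Polynomial.X - C (cubicPart E) := by
      rw [polynomial, linearPart, cubicPart]
    have (g : F[X][X])
        (hg : g = Polynomial.X ^ 2 + C (linearPart E) * Polynomial.X - C (cubicPart E)) :
        g.eval₂ (algebraMap F[X] E.toAffine.CoordinateRing)
          (-coordY E - algebraMap F[X] _ (linearPart E)) = 0 := by
      rw [hg, eval₂_sub, eval₂_add, eval₂_mul, eval₂_pow, eval₂_X, eval₂_C, eval₂_C]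
      linear_combination coordY_sq E
    exact this _ hp

lemma negHom_coordY : negHom E (coordY E) = -coordY E - algebraMap F[X] _ (linearPart E) :=
  AdjoinRoot.liftAlgHom_root ..

lemma negHom_negHom (z) : negHom E (negHom E z) = z := by
  obtain ⟨p, q, rfl⟩ := CoordinateRing.exists_smul_basis_eq z
  change negHom E (negHom E (p • 1 + q • coordY E)) = p • 1 + q • coordY E
  simp only [map_add, map_smul, map_one, map_sub, map_neg, negHom_coordY, AlgHom.commutes]
  ring_nf

lemma algebraMap_comp_negHom_injective : Function.Injective
    ((IsScalarTower.toAlgHom F E.toAffine.CoordinateRing E.toAffine.FunctionField).comp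
      ((negHom E).restrictScalars F)) :=
  (FaithfulSMul.algebraMap_injective E.toAffine.CoordinateRing E.toAffine.FunctionField).comp
    (Function.LeftInverse.injective (negHom_negHom E))

/-- The involution of the function field induced by negation on the curve. -/
noncomputable def negFun : E.toAffine.FunctionField →ₐ[F] E.toAffine.FunctionField :=
  IsFractionRing.liftAlgHom (R := F) (A := E.toAffine.CoordinateRing)
    (algebraMap_comp_negHom_injective E)

lemma negFun_algebraMap (z : E.toAffine.CoordinateRing) :
    negFun E (algebraMap _ _ z) = algebraMap _ _ (negHom E z) :=
  IsFractionRing.lift_algebraMap (g := (AlgHom.toRingHom _)) (algebraMap_comp_negHom_injective E) z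

lemma negHom_basis (p q : F[X]) :
    negHom E (p • 1 + q • coordY E) = (p - q * linearPart E) • 1 + (-q) • coordY E := by
  rw [map_add, map_smul, map_smul, map_one, negHom_coordY]
  simp only [Algebra.smul_def, map_sub, map_mul, map_neg]
  ring

lemma eq_of_basis_eq {p q p' q' : F[X]} (h : p • 1 + q • coordY E = p' • 1 + q' • coordY E) :
    p = p' ∧ q = q' := by
  have := CoordinateRing.smul_basis_eq_zero (W' := E.toAffine) (p := p - p') (q := q - q') <| by
    change (p - p') • 1 + (q - q') • coordY E = 0
    rw [sub_smul, sub_smul]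
    linear_combination h
  exact ⟨sub_eq_zero.1 this.1, sub_eq_zero.1 this.2⟩

variable {E} in
lemma exists_algebraMap_eq_of_negHom_eq [E.IsElliptic] {w : E.toAffine.CoordinateRing}
    (hw : negHom E w = w) : ∃ u : F[X], algebraMap _ _ u = w := by
  obtain ⟨p, q, rfl⟩ := CoordinateRing.exists_smul_basis_eq w
  obtain ⟨h1, h2⟩ := eq_of_basis_eq E ((negHom_basis E p q).symm.trans hw)
  suffices q = 0 by
    refine ⟨p, ?_⟩
    rw [this, zero_smul, add_zero, Algebra.smul_def, mul_one]
  by_contra hq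
  have hh : linearPart E = 0 := by
    have : q * linearPart E = 0 := by linear_combination -h1
    exact (mul_eq_zero.1 this).resolve_left hq
  have h2 : (2 : F) = 0 := by
    have : q * C 2 = 0 := by
      rw [map_ofNat]
      linear_combination -h2
    exact C_eq_zero.1 ((mul_eq_zero.1 this).resolve_left hq)
  have ha₃ : E.a₃ = 0 := by simpa [linearPart] using congrArg (eval 0) hh
  have ha₁ : E.a₁ = 0 := by simpa [linearPart, ha₃] using congrArg (eval 1) hh
  refine E.isUnit_Δ.ne_zero ?_
  rw [Δ, b₂, b₄, b₆, ha₁, ha₃, show (4 : F) = 2 * 2 by norm_num, h2]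
  ring

variable {E} in
lemma exists_algebraMap_mul_eq_of_negFun_eq [E.IsElliptic] {z : E.toAffine.FunctionField}
    (hz : negFun E z = z) : ∃ n d : F[X], d ≠ 0 ∧ algebraMap _ _ n = algebraMap _ _ d * z := by
  obtain ⟨r, s, hs, rfl⟩ := IsFractionRing.div_surjective (A := E.toAffine.CoordinateRing) z
  have hs0 : s ≠ 0 := nonZeroDivisors.ne_zero hs
  have hinj := FaithfulSMul.algebraMap_injective E.toAffine.CoordinateRing E.toAffine.FunctionField
  have hs0' : algebraMap _ E.toAffine.FunctionField s ≠ 0 := by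
    rwa [Ne, map_eq_zero_iff _ hinj]
  obtain ⟨d, hd⟩ := exists_algebraMap_eq_of_negHom_eq (w := s * negHom E s) <| by
    rw [map_mul, negHom_negHom, mul_comm]
  obtain ⟨n, hn⟩ := exists_algebraMap_eq_of_negHom_eq (w := r * negHom E s) <| by
    have h2 : negHom E s ≠ 0 := by
      rwa [Ne, map_eq_zero_iff _ (Function.LeftInverse.injective (negHom_negHom E))]
    have h2' : algebraMap _ E.toAffine.FunctionField (negHom E s) ≠ 0 := by
      rwa [Ne, map_eq_zero_iff _ hinj]
    rw [map_div₀, negFun_algebraMap, negFun_algebraMap, div_eq_div_iff h2' hs0', ← map_mul,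
      ← map_mul] at hz
    rw [map_mul, negHom_negHom, hinj hz]
  refine ⟨n, d, ?_, ?_⟩
  · rintro rfl
    rw [map_zero, eq_comm, mul_eq_zero] at hd
    refine hd.elim hs0 fun h ↦ hs0 ?_
    rw [← negHom_negHom E s, h, map_zero]
  · rw [IsScalarTower.algebraMap_apply F[X] E.toAffine.CoordinateRing, hn,
      IsScalarTower.algebraMap_apply F[X] E.toAffine.CoordinateRing, hd, map_mul, map_mul]
    field_simp

variable {E} in
lemma exists_hasHeight_of_map_negFun_eq [E.IsElliptic] [DecidableEq E.toAffine.FunctionField]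
    {P : (E⁄E.toAffine.FunctionField).Point} (hP : Point.map (negFun E) P = -P) :
    ∃ n, HasHeight P n := by
  rcases P with _ | ⟨x, y, hxy⟩
  · refine exists_hasHeight (u := ![1, 0]) (c := 1) (fun h ↦ one_ne_zero (congrFun h 0)) ?_
    rw [← Point.zero_def, Point.xRep_zero]
    intro i
    fin_cases i <;> simp
  · rw [Point.map_some, Point.neg_some, Point.some.injEq] at hP
    obtain ⟨n, d, hd, h⟩ := exists_algebraMap_mul_eq_of_negFun_eq hP.1
    refine exists_hasHeight (u := ![n, d]) (c := algebraMap _ _ d) (fun h ↦ hd (congrFun h 1)) ?_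
    rw [Point.xRep_some]
    intro i
    fin_cases i <;> simp [h]

/-- The `x`-coordinate of the generic point. -/
noncomputable def genX : E.toAffine.FunctionField := algebraMap F[X] _ X

/-- The `y`-coordinate of the generic point. -/
noncomputable def genY : E.toAffine.FunctionField := algebraMap _ _ (coordY E)

lemma algebraMap_linearPart : algebraMap F[X] E.toAffine.FunctionField (linearPart E) =
    algebraMap F _ E.a₁ * genX E + algebraMap F _ E.a₃ := by
  simp [linearPart, genX, IsScalarTower.algebraMap_apply F F[X] E.toAffine.FunctionField]

lemma algebraMap_cubicPart : algebraMap F[X] E.toAffine.FunctionField (cubicPart E) =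
    genX E ^ 3 + algebraMap F _ E.a₂ * genX E ^ 2 + algebraMap F _ E.a₄ * genX E +
      algebraMap F _ E.a₆ := by
  simp [cubicPart, genX, IsScalarTower.algebraMap_apply F F[X] E.toAffine.FunctionField]

lemma genY_sq :
    genY E ^ 2 + algebraMap F[X] _ (linearPart E) * genY E =
      algebraMap F[X] _ (cubicPart E) := by
  have := congrArg (algebraMap E.toAffine.CoordinateRing E.toAffine.FunctionField) (coordY_sq E)
  rwa [map_add, map_mul, map_pow, ← IsScalarTower.algebraMap_apply,
    ← IsScalarTower.algebraMap_apply] at this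

lemma equation_gen : (E⁄E.toAffine.FunctionField).Equation (genX E) (genY E) := by
  have := genY_sq E
  rw [algebraMap_linearPart, algebraMap_cubicPart] at this
  rw [equation_iff]
  simp only [baseChange_a₁, baseChange_a₂, baseChange_a₃, baseChange_a₄, baseChange_a₆]
  linear_combination this

variable [E.IsElliptic]

instance : (E⁄E.toAffine.FunctionField).IsElliptic := inferInstanceAs (E.map _).IsElliptic

/-- The generic point of the curve. -/
noncomputable def genPoint : (E⁄E.toAffine.FunctionField).Point :=
  .some (genX E) (genY E) (equation_iff_nonsingular.1 (equation_gen E))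

lemma map_negFun_genPoint [DecidableEq E.toAffine.FunctionField] :
    Point.map (negFun E) (genPoint E) = -genPoint E := by
  rw [genPoint, Point.map_some, Point.neg_some, Point.some.injEq]
  constructor
  · rw [genX, IsScalarTower.algebraMap_apply F[X] E.toAffine.CoordinateRing, negFun_algebraMap,
      AlgHom.commutes]
  · rw [genY, negFun_algebraMap, negHom_coordY, map_sub, map_neg, ← IsScalarTower.algebraMap_apply,
      algebraMap_linearPart, negY]
    simp only [baseChange_a₁, baseChange_a₃]
    ring

lemma hasHeight_genPoint : HasHeight (genPoint E) 1 := by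
  refine ⟨![X, 1], ?_, ⟨?_, 0, ?_⟩, 1, ?_⟩
  · rw [IsUnimodular, Ideal.eq_top_iff_one]
    exact Ideal.subset_span ⟨1, rfl⟩
  · intro i
    fin_cases i <;> simp
  · simp
  · rw [genPoint, Point.xRep_some]
    intro i
    fin_cases i <;> simp [genX]

section Frobenius

variable [Fintype F] [DecidableEq E.toAffine.FunctionField]

/-- The image of the generic point under the Frobenius endomorphism. -/
noncomputable def frobPoint : (E⁄E.toAffine.FunctionField).Point :=
  Point.map (FiniteField.frobeniusAlgHom F E.toAffine.FunctionField) (genPoint E)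

lemma map_negFun_frobPoint :
    Point.map (negFun E) (frobPoint E) = -frobPoint E := by
  have hc : (negFun E).comp (FiniteField.frobeniusAlgHom F E.toAffine.FunctionField) =
      (FiniteField.frobeniusAlgHom F E.toAffine.FunctionField).comp (negFun E) :=
    AlgHom.ext fun z ↦ by simp
  rw [frobPoint, Point.map_map, hc, ← Point.map_map, map_negFun_genPoint, map_neg]

lemma hasHeight_frobPoint : HasHeight (frobPoint E) (Fintype.card F) := by
  refine ⟨![X ^ Fintype.card F, 1], ?_, ⟨?_, 0, ?_⟩, 1, ?_⟩
  · rw [IsUnimodular, Ideal.eq_top_iff_one]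
    exact Ideal.subset_span ⟨1, rfl⟩
  · intro i
    fin_cases i <;> simp
  · simp
  · rw [frobPoint, genPoint, Point.map_some, Point.xRep_some]
    intro i
    fin_cases i <;> simp [genX]

lemma exists_hasHeight_frobPoint_add_zsmul (n : ℤ) :
    ∃ m, HasHeight (frobPoint E + n • genPoint E) m := by
  refine exists_hasHeight_of_map_negFun_eq ?_
  rw [map_add, map_zsmul, map_negFun_frobPoint, map_negFun_genPoint, smul_neg,
    ← neg_add_rev, add_comm]

end Frobenius

end WeierstrassCurve.Affine

lemma FiniteField.exists_algebraMap_eq_of_pow_card_eq {F L : Type*} [Field F] [Fintype F]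
    [Field L] [Algebra F L] {y : L} (hy : y ^ Fintype.card F = y) :
    ∃ z, algebraMap F L z = y := by
  have hne := X_pow_card_sub_X_ne_zero F Fintype.one_lt_card (p := Fintype.card F)
  have hs : (X ^ Fintype.card F - X : F[X]).Splits := by
    rw [splits_iff_card_roots, roots_X_pow_card_sub_X,
      X_pow_card_sub_X_natDegree_eq F Fintype.one_lt_card]
    rfl
  refine hs.mem_range_of_isRoot hne ?_
  simp [hy]

namespace WeierstrassCurve.Affine

variable {F : Type*} [Field F] (E : WeierstrassCurve F)

section FrobeniusCoordinates

variable [Fintype F]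

lemma linearPart_pow_card :
    linearPart E ^ Fintype.card F = C E.a₁ * X ^ Fintype.card F + C E.a₃ := by
  rw [← FiniteField.expand_card]
  simp [linearPart]

lemma cubicPart_pow_card : cubicPart E ^ Fintype.card F =
    (X ^ Fintype.card F) ^ 3 + C E.a₂ * (X ^ Fintype.card F) ^ 2 +
      C E.a₄ * X ^ Fintype.card F + C E.a₆ := by
  rw [← FiniteField.expand_card]
  simp [cubicPart]

variable {E} {A B : F[X]} (hAB : A • 1 + B • coordY E = coordY E ^ Fintype.card F)

include hAB

lemma two_mul_sub_of_coordY_pow : 2 * A - B * linearPart E + linearPart E ^ Fintype.card F = 0 := by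
  have h : negHom E (coordY E ^ Fintype.card F) =
      -(coordY E ^ Fintype.card F) - algebraMap F[X] _ (linearPart E ^ Fintype.card F) := by
    have := map_sub (FiniteField.frobeniusAlgHom F E.toAffine.CoordinateRing)
      (-coordY E) (algebraMap F[X] _ (linearPart E))
    rw [map_neg] at this
    simp only [FiniteField.frobeniusAlgHom_apply] at this
    rw [map_pow, negHom_coordY, this, map_pow]
  rw [← hAB, negHom_basis] at h
  have := (eq_of_basis_eq E (p' := -A - linearPart E ^ Fintype.card F) (q' := -B) (h.trans ?_)).1
  · linear_combination this
  · simp only [Algebra.smul_def, map_sub, map_neg]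
    ring

lemma sq_add_of_coordY_pow :
    A ^ 2 + B ^ 2 * cubicPart E + linearPart E ^ Fintype.card F * A =
      cubicPart E ^ Fintype.card F := by
  have h := congrArg (FiniteField.frobeniusAlgHom F E.toAffine.CoordinateRing) (coordY_sq E)
  rw [map_add, map_mul, map_pow] at h
  simp only [FiniteField.frobeniusAlgHom_apply] at h
  rw [← hAB, ← map_pow, ← map_pow] at h
  refine (eq_of_basis_eq E (q' := 0)
    (q := 2 * A * B - B ^ 2 * linearPart E + linearPart E ^ Fintype.card F * B)
    ?_).1
  simp only [Algebra.smul_def, map_add, map_sub, map_mul, map_pow, map_zero, map_ofNat] at h ⊢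
  linear_combination h - algebraMap F[X] _ B ^ 2 * coordY_sq E

lemma degree_le_of_coordY_pow :
    2 * A.natDegree ≤ 3 * Fintype.card F ∧ 2 * B.natDegree + 3 ≤ 3 * Fintype.card F := by
  have h1 : (Algebra.norm F[X] (coordY E)).natDegree = 3 := by
    have := CoordinateRing.degree_norm_smul_basis (W' := E.toAffine) 0 1
    rw [zero_smul, one_smul, zero_add] at this
    refine natDegree_eq_of_degree_eq_some (this.trans ?_)
    simp
  have h2 : (Algebra.norm F[X] (coordY E ^ Fintype.card F)).natDegree = 3 * Fintype.card F := by
    rw [map_pow, natDegree_pow, h1, mul_comm]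
  have h3 := CoordinateRing.degree_norm_smul_basis (W' := E.toAffine) A B
  change (Algebra.norm F[X] (A • 1 + B • coordY E)).degree = _ at h3
  rw [hAB] at h3
  have h4 := h3.symm.trans_le degree_le_natDegree
  rw [h2, max_le_iff] at h4
  constructor
  · by_cases hA : A = 0
    · simp [hA]
    · rw [degree_eq_natDegree hA, nsmul_eq_mul, nsmul_eq_mul] at h4
      exact_mod_cast h4.1
  · by_cases hB : B = 0
    · have := Fintype.card_pos (α := F)
      simp only [hB, natDegree_zero]
      omega
    · rw [degree_eq_natDegree hB, nsmul_eq_mul, nsmul_eq_mul] at h4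
      exact_mod_cast h4.2

lemma eval_add_of_coordY_pow {L : Type*} [Field L] [Algebra F L] (x : F) {y : L}
    (hy : y ^ 2 + algebraMap F L ((linearPart E).eval x) * y =
      algebraMap F L ((cubicPart E).eval x)) :
    algebraMap F L (A.eval x) + algebraMap F L (B.eval x) * y = y ^ Fintype.card F := by
  let φ : F[X] →+* L := (algebraMap F L).comp (evalRingHom x)
  have hφ : E.toAffine.polynomial.eval₂ φ y = 0 := by
    have hp : E.toAffine.polynomial = Polynomial.X ^ 2 + C (linearPart E) * Polynomial.X
        - C (cubicPart E) := by
      rw [polynomial, linearPart, cubicPart]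
    rw [hp]
    rw [eval₂_sub, eval₂_add, eval₂_mul, eval₂_pow, eval₂_X, eval₂_C, eval₂_C]
    exact sub_eq_zero.2 hy
  let ψ : E.toAffine.CoordinateRing →+* L := AdjoinRoot.lift φ y hφ
  have hψ (p : F[X]) : ψ (algebraMap F[X] _ p) = algebraMap F L (p.eval x) :=
    AdjoinRoot.lift_of hφ
  have hψ' : ψ (coordY E) = y := AdjoinRoot.lift_root hφ
  have := congrArg ψ hAB
  simpa only [Algebra.smul_def, map_add, map_mul, map_pow, map_one, mul_one, hψ, hψ'] using this

end FrobeniusCoordinates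

end WeierstrassCurve.Affine

namespace WeierstrassCurve.Affine

variable {F : Type*} [Field F] [Fintype F] (E : WeierstrassCurve F)

/-- The numerator of the `x`-coordinate of the sum of the Frobenius point and `± genPoint`, where
the chord through the two points has slope `(A + B y) / (X ^ q - X)`. -/
noncomputable def chordNum (A B : F[X]) : F[X] :=
  A ^ 2 + B ^ 2 * cubicPart E + C E.a₁ * A * (X ^ Fintype.card F - X) -
    (C E.a₂ + X ^ Fintype.card F + X) * (X ^ Fintype.card F - X) ^ 2

lemma algebraMap_genX_pow_sub : algebraMap F[X] E.toAffine.FunctionField (X ^ Fintype.card F - X) =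
    genX E ^ Fintype.card F - genX E := by
  simp [genX]

lemma genX_pow_ne_genX : genX E ^ Fintype.card F ≠ genX E := by
  rw [← sub_ne_zero, ← algebraMap_genX_pow_sub, Ne,
    map_eq_zero_iff _ (FaithfulSMul.algebraMap_injective F[X] E.toAffine.FunctionField)]
  exact FiniteField.X_pow_card_sub_X_ne_zero F Fintype.one_lt_card

section Chord

variable {E} {A B : F[X]}

lemma algebraMap_chordNum
    (h : 2 * A - B * linearPart E + C E.a₁ * (X ^ Fintype.card F - X) = 0)
    {ℓ : E.toAffine.FunctionField} (hℓ : ℓ * (genX E ^ Fintype.card F - genX E) =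
      algebraMap F[X] _ A + algebraMap F[X] _ B * genY E) :
    algebraMap F[X] _ (chordNum E A B) = (genX E ^ Fintype.card F - genX E) ^ 2 *
      (E⁄E.toAffine.FunctionField).toAffine.addX (genX E ^ Fintype.card F) (genX E) ℓ := by
  have hC (a : F) : algebraMap F[X] E.toAffine.FunctionField (C a) = algebraMap F _ a :=
    (IsScalarTower.algebraMap_apply F F[X] E.toAffine.FunctionField a).symm
  have hX : algebraMap F[X] E.toAffine.FunctionField X = genX E := rfl
  have h' := congrArg (algebraMap F[X] E.toAffine.FunctionField) h
  simp only [map_add, map_sub, map_mul, map_pow, map_zero, map_ofNat, hC, hX] at h'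
  rw [addX, baseChange_a₁, baseChange_a₂]
  simp only [chordNum, map_add, map_sub, map_mul, map_pow, hC, hX]
  linear_combination -(algebraMap F[X] _ B * genY E) * h' - algebraMap F[X] _ B ^ 2 * genY_sq E -
    (ℓ * (genX E ^ Fintype.card F - genX E) + algebraMap F[X] _ A + algebraMap F[X] _ B * genY E +
      algebraMap F _ E.a₁ * (genX E ^ Fintype.card F - genX E)) * hℓ

lemma X_sub_C_dvd_X_pow_card_sub_X (x : F) : X - C x ∣ (X ^ Fintype.card F - X : F[X]) := by
  rw [dvd_iff_isRoot]
  simp [FiniteField.pow_card]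

lemma X_sub_C_dvd_chordNum {x : F}
    (h : A.eval x ^ 2 + B.eval x ^ 2 * (cubicPart E).eval x = 0) :
    X - C x ∣ chordNum E A B := by
  rw [dvd_iff_isRoot]
  simpa [chordNum, FiniteField.pow_card] using h

lemma X_sub_C_sq_dvd_chordNum {x : F} (hA : A.eval x = 0) (hB : B.eval x = 0) :
    (X - C x) ^ 2 ∣ chordNum E A B := by
  obtain ⟨A, rfl⟩ := dvd_iff_isRoot.2 hA
  obtain ⟨B, rfl⟩ := dvd_iff_isRoot.2 hB
  obtain ⟨D, hD⟩ := X_sub_C_dvd_X_pow_card_sub_X x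
  refine ⟨A ^ 2 + B ^ 2 * cubicPart E + C E.a₁ * A * D - (C E.a₂ + X ^ Fintype.card F + X) * D ^ 2,
    ?_⟩
  rw [chordNum, hD]
  ring

end Chord

section FrobeniusCoordinates

variable {E} {A B : F[X]} (hAB : A • 1 + B • coordY E = coordY E ^ Fintype.card F)

lemma linearPart_pow_card_sub :
    linearPart E ^ Fintype.card F - linearPart E = C E.a₁ * (X ^ Fintype.card F - X) := by
  rw [linearPart_pow_card, linearPart]
  ring

include hAB

lemma chordNum_sub_one : chordNum E A (B - 1) =
    -(C E.a₃ + C E.a₁ * X) * A - 2 * B * cubicPart E + cubicPart E + C E.a₄ * X ^ Fintype.card F +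
      C E.a₆ + C E.a₂ * (2 * X ^ Fintype.card F * X - X ^ 2) + (X ^ Fintype.card F) ^ 2 * X +
        X ^ Fintype.card F * X ^ 2 - X ^ 3 := by
  have h1 := sq_add_of_coordY_pow hAB
  rw [linearPart_pow_card, cubicPart_pow_card] at h1
  rw [chordNum]
  linear_combination h1

lemma chordNum_add_one : chordNum E (A + linearPart E) (B + 1) =
    linearPart E * A + linearPart E ^ 2 + 2 * B * cubicPart E + cubicPart E +
      C E.a₁ * linearPart E * (X ^ Fintype.card F - X) + C E.a₄ * X ^ Fintype.card F +
      C E.a₆ + C E.a₂ * (2 * X ^ Fintype.card F * X - X ^ 2) + (X ^ Fintype.card F) ^ 2 * X +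
        X ^ Fintype.card F * X ^ 2 - X ^ 3 := by
  have h1 := sq_add_of_coordY_pow hAB
  rw [linearPart_pow_card, cubicPart_pow_card] at h1
  rw [chordNum, linearPart]
  linear_combination h1

lemma natDegree_chordNum_sub_one_le :
    (chordNum E A (B - 1)).natDegree ≤ 2 * Fintype.card F + 1 := by
  obtain ⟨hA, hB⟩ := degree_le_of_coordY_pow hAB
  have hq := Fintype.one_lt_card (α := F)
  rw [chordNum_sub_one hAB, cubicPart]
  compute_degree
  omega

lemma natDegree_chordNum_add_one_le :
    (chordNum E (A + linearPart E) (B + 1)).natDegree ≤ 2 * Fintype.card F + 1 := by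
  obtain ⟨hA, hB⟩ := degree_le_of_coordY_pow hAB
  have hq := Fintype.one_lt_card (α := F)
  rw [chordNum_add_one hAB, cubicPart, linearPart]
  compute_degree
  omega

end FrobeniusCoordinates

end WeierstrassCurve.Affine

namespace WeierstrassCurve.Affine

variable {F : Type*} [Field F] [Fintype F] {E : WeierstrassCurve F}

lemma prod_X_sub_C_pow_dvd {k : F → ℕ} {p : F[X]} (h : ∀ x, (X - C x) ^ k x ∣ p) :
    ∏ x, (X - C x) ^ k x ∣ p :=
  Finset.prod_dvd_of_coprime (fun _ _ _ _ hxy ↦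
    (pairwise_coprime_X_sub_C Function.injective_id hxy).pow) fun x _ ↦ h x

lemma natDegree_prod_X_sub_C_pow (k : F → ℕ) :
    (∏ x, (X - C x) ^ k x).natDegree = ∑ x, k x := by
  rw [natDegree_prod_of_monic _ _ fun x _ ↦ (monic_X_sub_C x).pow _]
  simp

lemma frobPoint_eq [E.IsElliptic] [DecidableEq E.toAffine.FunctionField] : ∃ h, frobPoint E =
    .some (genX E ^ Fintype.card F) (genY E ^ Fintype.card F) h := by
  rw [frobPoint, genPoint, Point.map_some]
  exact ⟨_, rfl⟩

lemma algebraMap_coordY_pow {A B : F[X]}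
    (hAB : A • 1 + B • coordY E = coordY E ^ Fintype.card F) :
    genY E ^ Fintype.card F = algebraMap F[X] _ A + algebraMap F[X] _ B * genY E := by
  have := congrArg (algebraMap E.toAffine.CoordinateRing E.toAffine.FunctionField) hAB
  rw [Algebra.smul_def, Algebra.smul_def, mul_one, map_add, map_mul,
    ← IsScalarTower.algebraMap_apply, ← IsScalarTower.algebraMap_apply, map_pow] at this
  exact this.symm

lemma add_sum_le_of_hasHeight {A B : F[X]} {ℓ : E.toAffine.FunctionField}
    (h : 2 * A - B * linearPart E + C E.a₁ * (X ^ Fintype.card F - X) = 0)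
    (hℓ : ℓ * (genX E ^ Fintype.card F - genX E) =
      algebraMap F[X] _ A + algebraMap F[X] _ B * genY E)
    {P : (E⁄E.toAffine.FunctionField).Point} {n m : ℕ} (hP : HasHeight P n)
    (hx : P.xRep = ![(E⁄E.toAffine.FunctionField).toAffine.addX (genX E ^ Fintype.card F)
      (genX E) ℓ, 1])
    (hm : (chordNum E A B).natDegree ≤ m) (hm' : 2 * Fintype.card F ≤ m) {k : F → ℕ}
    (hk : ∀ x, k x ≤ 2) (hdvd : ∀ x, (X - C x) ^ k x ∣ chordNum E A B) :
    n + ∑ x, k x ≤ m := by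
  have hD := FiniteField.X_pow_card_sub_X_ne_zero F (Fintype.one_lt_card (α := F))
  rw [← natDegree_prod_X_sub_C_pow]
  refine hP.add_natDegree_le (u := ![chordNum E A B, (X ^ Fintype.card F - X) ^ 2])
    (c := (genX E ^ Fintype.card F - genX E) ^ 2) (fun h ↦ pow_ne_zero 2 hD (congrFun h 1)) ?_
    (fun i ↦ prod_X_sub_C_pow_dvd fun x ↦ ?_) ?_
  · rw [hx, Fin.forall_fin_two]
    exact ⟨algebraMap_chordNum h hℓ, by simp [genX]⟩
  · revert i
    rw [Fin.forall_fin_two]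
    exact ⟨hdvd x, (pow_dvd_pow _ (hk x)).trans (pow_dvd_pow_of_dvd
      (X_sub_C_dvd_X_pow_card_sub_X x) 2)⟩
  · rw [Fin.forall_fin_two]
    refine ⟨hm, ?_⟩
    refine natDegree_pow_le.trans ?_
    rwa [FiniteField.X_pow_card_sub_X_natDegree_eq F Fintype.one_lt_card]

section Fiber

variable [DecidableEq F] (E)

/-- The ordinates of the affine points of `E` with abscissa `x`. -/
noncomputable def fiber (x : F) : Finset F :=
  {y | y ^ 2 + (linearPart E).eval x * y = (cubicPart E).eval x}

variable {E}

lemma mem_fiber {x y : F} :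
    y ∈ fiber E x ↔ y ^ 2 + (linearPart E).eval x * y = (cubicPart E).eval x := by
  simp [fiber]

lemma fiber_eq {x y : F} (hy : y ∈ fiber E x) : fiber E x = {y, -(linearPart E).eval x - y} := by
  ext z
  rw [mem_fiber] at hy
  rw [mem_fiber, ← hy, Finset.mem_insert, Finset.mem_singleton, ← sub_eq_zero,
    ← sub_eq_zero (a := z), ← sub_eq_zero (a := z), ← mul_eq_zero]
  ring_nf

lemma card_fiber_le (x : F) : (fiber E x).card ≤ 2 := by
  rcases (fiber E x).eq_empty_or_nonempty with h | ⟨y, hy⟩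
  · simp [h]
  · rw [fiber_eq hy]
    exact Finset.card_le_two

variable {A B : F[X]} (hAB : A • 1 + B • coordY E = coordY E ^ Fintype.card F)

include hAB

lemma eval_of_fiber_eq_empty {x : F} (hx : fiber E x = ∅) :
    (A + linearPart E).eval x = 0 ∧ (B + 1).eval x = 0 := by
  let L := AlgebraicClosure F
  have hinj := FaithfulSMul.algebraMap_injective F L
  obtain ⟨y, hy⟩ : ∃ y : L, y ^ 2 + algebraMap F L ((linearPart E).eval x) * y =
      algebraMap F L ((cubicPart E).eval x) := by
    have hd : (X ^ 2 + C (algebraMap F L ((linearPart E).eval x)) * X -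
        C (algebraMap F L ((cubicPart E).eval x))).degree = 2 := by
      compute_degree!
    obtain ⟨y, hy⟩ := IsAlgClosed.exists_root _ (hd.trans_ne two_ne_zero)
    exact ⟨y, sub_eq_zero.1 (by simpa using hy)⟩
  have hyF (z : F) : algebraMap F L z ≠ y := by
    rintro rfl
    refine Finset.notMem_empty z (hx ▸ mem_fiber.2 (hinj ?_))
    simpa using hy
  have hroot := eval_add_of_coordY_pow hAB x hy
  have hfrob := congrArg (FiniteField.frobeniusAlgHom F L) hy
  simp only [map_add, map_mul, map_pow, AlgHom.commutes, FiniteField.frobeniusAlgHom_apply]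
    at hfrob
  have hconj : y ^ Fintype.card F = -algebraMap F L ((linearPart E).eval x) - y := by
    have : (y ^ Fintype.card F - y) *
        (y ^ Fintype.card F - (-algebraMap F L ((linearPart E).eval x) - y)) = 0 := by
      linear_combination hfrob - hy
    refine sub_eq_zero.1 ((mul_eq_zero.1 this).resolve_left fun h ↦ ?_)
    obtain ⟨z, hz⟩ := FiniteField.exists_algebraMap_eq_of_pow_card_eq (sub_eq_zero.1 h)
    exact hyF z hz
  have key : algebraMap F L ((A + linearPart E).eval x) + algebraMap F L ((B + 1).eval x) * y =
      0 := by
    rw [eval_add, eval_add, eval_one, map_add, map_add, map_one]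
    linear_combination hroot + hconj
  have hB : (B + 1).eval x = 0 := by
    by_contra hB
    have hB' : algebraMap F L ((B + 1).eval x) ≠ 0 := (_root_.map_ne_zero _).2 hB
    refine hyF (-(A + linearPart E).eval x / (B + 1).eval x) ?_
    rw [map_div₀, map_neg, div_eq_iff hB']
    linear_combination -key
  rw [hB, map_zero, zero_mul, add_zero, map_eq_zero] at key
  exact ⟨key, hB⟩

lemma eval_add_of_mem_fiber {x y : F} (hy : y ∈ fiber E x) : A.eval x + B.eval x * y = y := by
  have := eval_add_of_coordY_pow (L := F) hAB x (mem_fiber.1 hy)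
  rwa [FiniteField.pow_card] at this

lemma pow_card_fiber_dvd_chordNum (x : F) :
    (X - C x) ^ (fiber E x).card ∣ chordNum E A (B - 1) ∧
      (X - C x) ^ (2 - (fiber E x).card) ∣ chordNum E (A + linearPart E) (B + 1) := by
  rcases (fiber E x).eq_empty_or_nonempty with h | ⟨y, hy⟩
  · obtain ⟨hA, hB⟩ := eval_of_fiber_eq_empty hAB h
    rw [h, Finset.card_empty]
    exact ⟨one_dvd _, X_sub_C_sq_dvd_chordNum hA hB⟩
  have h0 := eval_add_of_mem_fiber hAB hy
  have hmem := mem_fiber.1 hy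
  by_cases hy' : y = -(linearPart E).eval x - y
  · rw [fiber_eq hy, ← hy', Finset.pair_eq_singleton, Finset.card_singleton, pow_one]
    constructor
    · refine X_sub_C_dvd_chordNum ?_
      rw [eval_sub, eval_one, ← hmem]
      grind
    · refine X_sub_C_dvd_chordNum ?_
      rw [eval_add, eval_add, eval_one, ← hmem]
      grind
  · have h1 := eval_add_of_mem_fiber hAB
      (show -(linearPart E).eval x - y ∈ fiber E x by rw [fiber_eq hy]; simp)
    have hB : (B - 1).eval x = 0 := by
      rw [eval_sub, eval_one]
      refine (mul_eq_zero.1 ?_).resolve_right (sub_ne_zero.2 hy')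
      linear_combination h0 - h1
    have hA : A.eval x = 0 := by
      rw [eval_sub, eval_one] at hB
      linear_combination h0 - y * hB
    rw [fiber_eq hy, Finset.card_pair hy']
    exact ⟨X_sub_C_sq_dvd_chordNum hA hB, one_dvd _⟩

omit hAB

lemma card_point [E.IsElliptic] : Nat.card E.toAffine.Point = ∑ x, (fiber E x).card + 1 := by
  have h : Nat.card {xy : F × F // E.toAffine.Equation xy.1 xy.2} = ∑ x, (fiber E x).card := by
    classical
    rw [Nat.card_eq_fintype_card, Fintype.card_subtype, Finset.card_filter,
      ← Finset.univ_product_univ, Finset.sum_product]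
    refine Finset.sum_congr rfl fun x _ ↦ ?_
    rw [fiber, Finset.card_filter]
    refine Finset.sum_congr rfl fun y _ ↦ if_congr ?_ rfl rfl
    rw [equation_iff]
    simp only [linearPart, cubicPart, eval_add, eval_mul, eval_pow, eval_C, eval_X]
    ring_nf
  rw [Nat.card_congr E.toAffine.pointEquiv, ← h]
  exact Finite.card_option

section Height

variable [E.IsElliptic] [DecidableEq E.toAffine.FunctionField]

lemma add_card_point_le_of_hasHeight {n : ℕ} (h : HasHeight (frobPoint E + genPoint E) n) :
    n + Nat.card E.toAffine.Point ≤ 2 * Fintype.card F + 2 := by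
  obtain ⟨A, B, hAB⟩ := CoordinateRing.exists_smul_basis_eq (coordY E ^ Fintype.card F)
  change A • 1 + B • coordY E = _ at hAB
  have hne := sub_ne_zero.2 (genX_pow_ne_genX E)
  obtain ⟨hns, hfrob⟩ := frobPoint_eq (E := E)
  have := add_sum_le_of_hasHeight (hP := h) (A := A) (B := B - 1)
    (ℓ := (E⁄E.toAffine.FunctionField).toAffine.slope (genX E ^ Fintype.card F) (genX E)
      (genY E ^ Fintype.card F) (genY E)) ?_ ?_ ?_ (natDegree_chordNum_sub_one_le hAB) (by omega)
    card_fiber_le fun x ↦ (pow_card_fiber_dvd_chordNum hAB x).1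
  · rw [card_point]
    omega
  · linear_combination two_mul_sub_of_coordY_pow hAB - linearPart_pow_card_sub (E := E)
  · rw [slope_of_X_ne (genX_pow_ne_genX E), div_mul_cancel₀ _ hne, algebraMap_coordY_pow hAB,
      map_sub, map_one]
    ring
  · rw [hfrob, genPoint, Point.add_of_X_ne (genX_pow_ne_genX E), Point.xRep_some]

lemma le_card_point_of_hasHeight {n : ℕ} (h : HasHeight (frobPoint E - genPoint E) n) :
    n ≤ Nat.card E.toAffine.Point := by
  obtain ⟨A, B, hAB⟩ := CoordinateRing.exists_smul_basis_eq (coordY E ^ Fintype.card F)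
  change A • 1 + B • coordY E = _ at hAB
  have hne := sub_ne_zero.2 (genX_pow_ne_genX E)
  obtain ⟨hns, hfrob⟩ := frobPoint_eq (E := E)
  have := add_sum_le_of_hasHeight (hP := h) (A := A + linearPart E) (B := B + 1)
    (ℓ := (E⁄E.toAffine.FunctionField).toAffine.slope (genX E ^ Fintype.card F) (genX E)
      (genY E ^ Fintype.card F) ((E⁄E.toAffine.FunctionField).toAffine.negY (genX E) (genY E)))
    ?_ ?_ ?_ (natDegree_chordNum_add_one_le hAB) (by omega)
    (fun _ ↦ Nat.sub_le ..) fun x ↦ (pow_card_fiber_dvd_chordNum hAB x).2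
  · have hsum : ∑ x, (2 - (fiber E x).card) + ∑ x, (fiber E x).card = 2 * Fintype.card F := by
      rw [← Finset.sum_add_distrib, Finset.sum_congr rfl fun x _ ↦
        Nat.sub_add_cancel (card_fiber_le (E := E) x)]
      simp [mul_comm]
    rw [card_point]
    omega
  · linear_combination two_mul_sub_of_coordY_pow hAB - linearPart_pow_card_sub (E := E)
  · rw [slope_of_X_ne (genX_pow_ne_genX E), div_mul_cancel₀ _ hne, algebraMap_coordY_pow hAB,
      map_add, map_add, map_one, negY, baseChange_a₁, baseChange_a₃, algebraMap_linearPart]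
    ring
  · rw [hfrob, genPoint, sub_eq_add_neg, Point.neg_some, Point.add_of_X_ne (genX_pow_ne_genX E),
      Point.xRep_some]

end Height

end Fiber

end WeierstrassCurve.Affine

lemma Int.eq_quadratic_of_recurrence {d : ℤ → ℤ}
    (hd : ∀ n, d (n + 1) + d (n - 1) = 2 * d n + 2) (n : ℤ) :
    d n = n ^ 2 + (1 + d 0 - d (-1)) * n + d 0 := by
  suffices d n = n ^ 2 + (1 + d 0 - d (-1)) * n + d 0 ∧
    d (n - 1) = (n - 1) ^ 2 + (1 + d 0 - d (-1)) * (n - 1) + d 0 from this.1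
  induction n with
  | zero =>
    rw [zero_sub]
    constructor <;> ring
  | succ n ih =>
    refine ⟨?_, by simpa using ih.1⟩
    linear_combination hd n + 2 * ih.1 - ih.2
  | pred n ih =>
    refine ⟨by simpa using ih.2, ?_⟩
    have := hd (-n - 1)
    rw [sub_add_cancel] at this
    linear_combination this + 2 * ih.2 - ih.1

namespace WeierstrassCurve.Affine

variable {F : Type*} [Field F] [Fintype F]

/-- The Hasse bound for the number of points of an elliptic curve over a finite field. -/
theorem sq_le_four_mul_card (E : WeierstrassCurve F) [E.IsElliptic] :
    (Fintype.card F + 1 - Nat.card E.toAffine.Point : ℤ) ^ 2 ≤ 4 * Fintype.card F := by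
  classical
  choose d hd using exists_hasHeight_frobPoint_add_zsmul E
  have hrec (n : ℤ) : (d (n + 1) + d (n - 1) : ℤ) = 2 * d n + 2 := by
    have := (hd n).parallelogram (hasHeight_genPoint E) (c := d (n + 1)) (d := d (n - 1))
      (by simpa only [add_assoc, ← add_one_zsmul] using hd (n + 1))
      (by simpa only [sub_one_zsmul, add_sub_assoc, ← sub_eq_add_neg] using hd (n - 1))
    exact_mod_cast this
  have h0 : d 0 = Fintype.card F := by
    refine HasHeight.unique ?_ (hasHeight_frobPoint E)
    simpa only [zero_zsmul, add_zero] using hd 0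
  have h1 : d (-1) = Nat.card E.toAffine.Point := by
    have hle := le_card_point_of_hasHeight (E := E) (n := d (-1)) (by
      simpa only [neg_smul, one_smul, ← sub_eq_add_neg] using hd (-1))
    have hge := add_card_point_le_of_hasHeight (E := E) (n := d 1) (by
      simpa only [one_smul] using hd 1)
    have := hrec 0
    rw [zero_add, zero_sub] at this
    omega
  have hquad (n : ℤ) := Int.eq_quadratic_of_recurrence (d := fun n ↦ d n) hrec n
  simp only [h0, h1] at hquad
  by_contra! hlt
  obtain ⟨b, hb | hb⟩ := Int.even_or_odd' (Fintype.card F + 1 - Nat.card E.toAffine.Point : ℤ)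
  · have := hquad (-b)
    have := Int.natCast_nonneg (d (-b))
    nlinarith
  · have hN : (Nat.card E.toAffine.Point : ℤ) = Fintype.card F - 2 * b := by linear_combination -hb
    rw [hN] at hquad hlt
    have e1 : d (-b) = 0 := by
      have := hquad (-b)
      have := Int.natCast_nonneg (d (-b))
      zify
      nlinarith
    have e2 : d (-b - 1) = 0 := by
      have := hquad (-b - 1)
      have := Int.natCast_nonneg (d (-b - 1))
      zify
      nlinarith
    obtain ⟨m, hm⟩ := exists_hasHeight_of_map_negFun_eq (E := E)
      (P := frobPoint E + (-b) • genPoint E + (frobPoint E + (-b - 1) • genPoint E)) <| by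
        rw [map_add, map_add, map_add, map_zsmul, map_zsmul, map_negFun_frobPoint,
          map_negFun_genPoint, smul_neg, smul_neg]
        abel
    have := (hd (-b)).parallelogram (hd (-b - 1)) hm (d := 1) <| by
      rw [add_sub_add_left_eq_sub, ← sub_smul, sub_sub_cancel, one_smul]
      exact hasHeight_genPoint E
    omega

end WeierstrassCurve.Affine

/-- If `a ^ 2 ≤ 4 * q`, the roots of `1 - a u + q u ^ 2` have absolute value `q ^ (-1 / 2)`. -/
lemma Complex.mul_normSq_eq_one_of_quadratic {a q : ℝ} (h : a ^ 2 ≤ 4 * q) {u : ℂ}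
    (hu : 1 - a * u + q * u ^ 2 = 0) : q * normSq u = 1 := by
  have hre := congrArg re hu
  have him := congrArg im hu
  simp [pow_two] at hre him
  rw [normSq_apply]
  have hf : u.im * (2 * q * u.re - a) = 0 := by linear_combination him
  rcases mul_eq_zero.1 hf with h0 | h0
  · rw [h0] at hre ⊢
    have h1 : (a * u.re - 2) ^ 2 ≤ 0 := by nlinarith [mul_le_mul_of_nonneg_right h (sq_nonneg u.re)]
    have h2 : a * u.re = 2 := by nlinarith
    linear_combination hre + h2
  · linear_combination -hre + u.re * h0

/-- Riemann hypothesis for elliptic curves over finite fields: every complex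
zero `s` of `L_E(s) = 1 - a q^{-s} + q^{1-2s}`, where `a = q + 1 - #E(F_q)`,
satisfies `Re s = 1/2`. -/
theorem riemann_hypothesis_elliptic_curve_finite_field (F : Type*) [Field F] [Fintype F]
    (E : WeierstrassCurve F) [E.IsElliptic]
    (q : ℕ) (hq : q = Fintype.card F)
    (a : ℝ) (ha : a = (q : ℝ) + 1 - (Nat.card E.toAffine.Point : ℝ)) :
    ∀ s : ℂ, 1 - (a : ℂ) * (q : ℂ) ^ (-s) + (q : ℂ) ^ (1 - 2 * s) = 0 → s.re = 1 / 2 := by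
  intro s hs
  have hq1 : 1 < q := hq ▸ Fintype.one_lt_card
  have hq0 : (0 : ℝ) < q := by positivity
  have hqc : (q : ℂ) ≠ 0 := by exact_mod_cast hq0.ne'
  have hasse : a ^ 2 ≤ 4 * (q : ℝ) := by
    rw [ha, hq]
    exact_mod_cast WeierstrassCurve.Affine.sq_le_four_mul_card E
  have hu : 1 - (a : ℂ) * (q : ℂ) ^ (-s) + ((q : ℝ) : ℂ) * ((q : ℂ) ^ (-s)) ^ 2 = 0 := by
    rw [← hs, ← Complex.cpow_nat_mul, Complex.ofReal_natCast, sub_eq_add_neg 1 (2 * s),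
      Complex.cpow_add _ _ hqc, Complex.cpow_one, Nat.cast_ofNat, mul_neg]
  have hn := Complex.mul_normSq_eq_one_of_quadratic hasse hu
  rw [Complex.normSq_eq_norm_sq, Complex.norm_natCast_cpow_of_pos (by omega), Complex.neg_re,
    ← Real.rpow_mul_natCast hq0.le] at hn
  have hlog := congrArg Real.log hn
  rw [Real.log_mul hq0.ne' (Real.rpow_pos_of_pos hq0 _).ne', Real.log_rpow hq0, Real.log_one,
    Nat.cast_ofNat] at hlog
  have hpos : 0 < Real.log q := Real.log_pos (by exact_mod_cast hq1)
  have : Real.log q * (1 - 2 * s.re) = 0 := by linear_combination hlog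
  linarith [(mul_eq_zero.1 this).resolve_left hpos.ne']
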